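/- arXiv:2306.02418 — 2 statements merged into one kernel-verified Lean document; each statement's English description precedes it below -/
import Mathlib

section
/- Let Z, H, C be finite types, let (Z,H) be a pair of random variables with joint probability mass function on Z × H, let σ : H → C be a function, and suppose that I(Z; σ(H)) = I(Z; H) (the representation σ(H) is maximally informative about Z). Then σ(H) is an information state: (P1) for every function f : Z → ℝ and every h with P(H = h) > 0, E[f(Z) | H = h] = E[f(Z) | σ(H) = σ(h)]; and (P2) for every update function φ : C × Z → C, every c' ∈ C, and every h with P(H = h) > 0, P(φ(σ(H), Z) = c' | H = h) = P(φ(σ(H), Z) = c' | σ(H) = σ(h)). -/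
/-!
STATEMENT 0 (paper Theorem 4.1, finite-probability version): if the representation
`σ(H)` is maximally informative about `Z`, i.e. `I(Z; σ(H)) = I(Z; H)`, then `σ(H)`
is an information state:
(P1) conditional expectations of any `f : Z → ℝ` given `H = h` and given `σ(H) = σ(h)` agree;
(P2) for any update rule `φ : C × Z → C`, the conditional law of `φ(σ(H), Z)` given
`H = h` equals its conditional law given `σ(H) = σ(h)`.
-/

open Finset

/-- Marginal over the first coordinate: `p_Z(z) = ∑ h, p(z, h)`. -/
noncomputable def margFst {Z H : Type*} [Fintype H] (p : Z → H → ℝ) (z : Z) : ℝ :=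
  ∑ h, p z h

/-- Marginal over the second coordinate: `p_H(h) = ∑ z, p(z, h)`. -/
noncomputable def margSnd {Z H : Type*} [Fintype Z] (p : Z → H → ℝ) (h : H) : ℝ :=
  ∑ z, p z h

/-- Mutual information of a joint pmf on finite types:
`I(Z;H) = ∑_{z,h : p(z,h) > 0} p(z,h) log( p(z,h) / (p_Z(z) p_H(h)) )`. -/
noncomputable def mutualInfo {Z H : Type*} [Fintype Z] [Fintype H] (p : Z → H → ℝ) : ℝ :=
  ∑ z, ∑ h,
    if 0 < p z h then p z h * Real.log (p z h / (margFst p z * margSnd p h)) else 0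

/-- The joint pmf of `(Z, σ(H))` induced by the joint pmf `p` of `(Z, H)`. -/
noncomputable def pushJoint {Z H C : Type*} [Fintype H] [DecidableEq C]
    (p : Z → H → ℝ) (σ : H → C) (z : Z) (c : C) : ℝ :=
  ∑ h ∈ Finset.univ.filter (fun h => σ h = c), p z h

/-- The equality case of the Gibbs inequality on a finite type. -/
theorem eq_of_sum_mul_log_div_eq_zero {ι : Type*} [Fintype ι] {p w : ι → ℝ}
    (hp : ∀ i, 0 ≤ p i) (hw : ∀ i, 0 ≤ w i) (hac : ∀ i, w i = 0 → p i = 0)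
    (hsum : ∑ i, w i = ∑ i, p i) (hlog : ∑ i, p i * Real.log (p i / w i) = 0) (i : ι) :
    p i = w i := by
  have hdiv (j : ι) : 0 ≤ p j / w j := div_nonneg (hp j) (hw j)
  have hterm (j : ι) : w j * InformationTheory.klFun (p j / w j)
      = p j * Real.log (p j / w j) + w j - p j := by
    by_cases h : w j = 0
    · simp [h, hac j h]
    · rw [InformationTheory.klFun]
      field_simp
  have hzero : ∑ j, w j * InformationTheory.klFun (p j / w j) = 0 := by
    simp_rw [hterm, sum_sub_distrib, sum_add_distrib, hlog, hsum]
    ring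
  have hi := (sum_eq_zero_iff_of_nonneg fun j _ =>
    mul_nonneg (hw j) (InformationTheory.klFun_nonneg (hdiv j))).1 hzero i (mem_univ i)
  rcases mul_eq_zero.1 hi with h | h
  · rw [h, hac i h]
  · rw [InformationTheory.klFun_eq_zero_iff (hdiv i)] at h
    exact eq_of_div_eq_one h

theorem mutualInfo_eq_sum {Z H : Type*} [Fintype Z] [Fintype H] {p : Z → H → ℝ}
    (hnn : ∀ z h, 0 ≤ p z h) :
    mutualInfo p = ∑ z, ∑ h, p z h * Real.log (p z h / (margFst p z * margSnd p h)) := by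
  refine sum_congr rfl fun z _ => sum_congr rfl fun h _ => ?_
  split_ifs with hpos
  · rfl
  · rw [le_antisymm (not_lt.1 hpos) (hnn z h), zero_mul]

section pushJoint

variable {Z H C : Type*} [Fintype H] [DecidableEq C] {p : Z → H → ℝ}

theorem sum_pushJoint_mul [Fintype C] (p : Z → H → ℝ) (σ : H → C) (z : Z) (g : C → ℝ) :
    ∑ c, pushJoint p σ z c * g c = ∑ h, p z h * g (σ h) := by
  rw [← sum_fiberwise univ σ]
  refine sum_congr rfl fun c _ => ?_
  rw [pushJoint, sum_mul]
  refine sum_congr rfl fun h hh => ?_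
  rw [(mem_filter.1 hh).2]

theorem margFst_pushJoint [Fintype C] (p : Z → H → ℝ) (σ : H → C) :
    margFst (pushJoint p σ) = margFst p := by
  ext z
  simpa [margFst] using sum_pushJoint_mul p σ z fun _ => 1

theorem pushJoint_nonneg (hnn : ∀ z h, 0 ≤ p z h) (σ : H → C) (z : Z) (c : C) :
    0 ≤ pushJoint p σ z c :=
  sum_nonneg fun h _ => hnn z h

theorem le_pushJoint (hnn : ∀ z h, 0 ≤ p z h) (σ : H → C) (z : Z) (h : H) :
    p z h ≤ pushJoint p σ z (σ h) :=
  single_le_sum (f := fun h => p z h) (fun h _ => hnn z h) (by simp)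

theorem margSnd_le_margSnd_pushJoint [Fintype Z] (hnn : ∀ z h, 0 ≤ p z h) (σ : H → C) (h : H) :
    margSnd p h ≤ margSnd (pushJoint p σ) (σ h) :=
  sum_le_sum fun z _ => le_pushJoint hnn σ z h

end pushJoint

theorem margSnd_nonneg {Z H : Type*} [Fintype Z] {p : Z → H → ℝ} (hnn : ∀ z h, 0 ≤ p z h)
    (h : H) : 0 ≤ margSnd p h :=
  sum_nonneg fun z _ => hnn z h

theorem le_margSnd {Z H : Type*} [Fintype Z] {p : Z → H → ℝ} (hnn : ∀ z h, 0 ≤ p z h)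
    (z : Z) (h : H) : p z h ≤ margSnd p h :=
  single_le_sum (f := fun z => p z h) (fun z _ => hnn z h) (mem_univ z)

theorem le_margFst {Z H : Type*} [Fintype H] {p : Z → H → ℝ} (hnn : ∀ z h, 0 ≤ p z h)
    (z : Z) (h : H) : p z h ≤ margFst p z :=
  single_le_sum (f := fun h => p z h) (fun h _ => hnn z h) (mem_univ h)

/-- If `σ(H)` is maximally informative about `Z`, then `Z` and `H` are conditionally independent
given `σ(H)`. -/
theorem eq_margSnd_mul_pushJoint_div_of_mutualInfo_eq {Z H C : Type*}
    [Fintype Z] [Fintype H] [Fintype C] [DecidableEq C] {p : Z → H → ℝ} {σ : H → C}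
    (hnn : ∀ z h, 0 ≤ p z h) (hMI : mutualInfo (pushJoint p σ) = mutualInfo p) (z : Z) (h : H) :
    p z h = margSnd p h * pushJoint p σ z (σ h) / margSnd (pushJoint p σ) (σ h) := by
  have hq := pushJoint_nonneg hnn σ
  have hpos {z : Z} {h : H} (hzh : 0 < p z h) : 0 < margSnd p h ∧ 0 < pushJoint p σ z (σ h) ∧
      0 < margSnd (pushJoint p σ) (σ h) :=
    ⟨hzh.trans_le (le_margSnd hnn z h), hzh.trans_le (le_pushJoint hnn σ z h),
      hzh.trans_le ((le_margSnd hnn z h).trans (margSnd_le_margSnd_pushJoint hnn σ h))⟩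
  refine eq_of_sum_mul_log_div_eq_zero (p := fun x : Z × H => p x.1 x.2)
    (w := fun x => margSnd p x.2 * pushJoint p σ x.1 (σ x.2) / margSnd (pushJoint p σ) (σ x.2))
    (fun x => hnn _ _)
    (fun x => div_nonneg (mul_nonneg (margSnd_nonneg hnn _) (hq _ _)) (margSnd_nonneg hq _))
    (fun x hx => ?_) ?_ ?_ (z, h)
  · by_contra hne
    obtain ⟨h₁, h₂, h₃⟩ := hpos ((hnn x.1 x.2).lt_of_ne' hne)
    exact (div_pos (mul_pos h₁ h₂) h₃).ne' hx
  · rw [Fintype.sum_prod_type_right, Fintype.sum_prod_type_right]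
    refine sum_congr rfl fun h _ => ?_
    dsimp only
    rw [← sum_div, ← mul_sum]
    change margSnd p h * margSnd (pushJoint p σ) (σ h) / _ = margSnd p h
    rcases (margSnd_nonneg hnn h).eq_or_lt with h0 | h0
    · simp [← h0]
    · exact mul_div_cancel_right₀ _ (h0.trans_le (margSnd_le_margSnd_pushJoint hnn σ h)).ne'
  · rw [mutualInfo_eq_sum hnn, mutualInfo_eq_sum hq, margFst_pushJoint] at hMI
    rw [Fintype.sum_prod_type, ← sub_eq_zero.2 hMI.symm, ← sum_sub_distrib]
    refine sum_congr rfl fun z _ => ?_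
    rw [sum_pushJoint_mul p σ z fun c => Real.log
      (pushJoint p σ z c / (margFst p z * margSnd (pushJoint p σ) c)), ← sum_sub_distrib]
    refine sum_congr rfl fun h _ => ?_
    dsimp only
    rcases (hnn z h).eq_or_lt with h0 | h0
    · simp [← h0]
    · obtain ⟨h₁, h₂, h₃⟩ := hpos h0
      have h₄ := h0.trans_le (le_margFst hnn z h)
      rw [← mul_sub, ← Real.log_div (by positivity) (by positivity)]
      congr 2
      field_simp

/-- **Maximally informative representations are information states** (P1 and P2). -/
theorem informationState_of_mutualInfo_eq {Z H C : Type*}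
    [Fintype Z] [Fintype H] [Fintype C] [DecidableEq C]
    (p : Z → H → ℝ) (σ : H → C)
    (hnn : ∀ z h, 0 ≤ p z h) (hsum : ∑ z, ∑ h, p z h = 1)
    (hMI : mutualInfo (pushJoint p σ) = mutualInfo p) :
    -- (P1) conditional expectations agree
    (∀ (f : Z → ℝ) (h : H), 0 < margSnd p h →
      (∑ z, p z h * f z) / margSnd p h
        = (∑ z, pushJoint p σ z (σ h) * f z) / margSnd (pushJoint p σ) (σ h)) ∧
    -- (P2) conditional laws of the updated representation agree
    (∀ (φ : C → Z → C) (c' : C) (h : H), 0 < margSnd p h →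
      (∑ z ∈ Finset.univ.filter (fun z => φ (σ h) z = c'), p z h) / margSnd p h
        = (∑ z ∈ Finset.univ.filter (fun z => φ (σ h) z = c'), pushJoint p σ z (σ h))
            / margSnd (pushJoint p σ) (σ h)) := by
  have hcond (z : Z) (h : H) (hh : 0 < margSnd p h) :
      p z h / margSnd p h = pushJoint p σ z (σ h) / margSnd (pushJoint p σ) (σ h) := by
    rw [div_eq_iff hh.ne', eq_margSnd_mul_pushJoint_div_of_mutualInfo_eq hnn hMI z h]
    ring
  refine ⟨fun f h hh => ?_, fun φ c' h hh => ?_⟩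
  · simp_rw [sum_div, mul_div_right_comm, hcond _ h hh]
  · simp_rw [sum_div, hcond _ h hh]
end

section
/- Let X be a finite type, let p and q be probability mass functions on X with q(x) > 0 for all x, and let M ≥ 1. Consider the joint distribution in which an index d is drawn uniformly from {1, ..., M}, the sample x_d is drawn from p, and the samples x_j for j ≠ d are drawn independently from q. For any scoring function f : X → ℝ_{>0}, define the InfoNCE cross-entropy loss L(f) = E[ − log( f(x_d) / Σ_{j=1}^{M} f(x_j) ) ], where the expectation is over d and (x_1, ..., x_M). Then the function f*(x) = p(x)/q(x) (whenever p(x) > 0, extended by an arbitrarily small positive value elsewhere, or equivalently any f proportional to p/q on the support of p with q-ratio form) satisfies L(f*) ≤ L(f) for every scoring function f : X → ℝ_{>0}; that is, the density-ratio scoring function minimizes the InfoNCE loss. -/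
/-!
STATEMENT 2 (minimization claim of paper Lemma A.2): the InfoNCE cross-entropy loss
`L(f) = E[ − log( f(x_d) / ∑_j f(x_j) ) ]`, where one batch element is drawn from `p`
and the remaining `M − 1` elements i.i.d. from `q > 0`, is minimized over positive
scoring functions by the density-ratio scoring function `f*(x) = p(x)/q(x)`.
-/

open Finset

/-- Joint pmf of the index `d` of the positive sample and the batch `x : Fin M → X`:
`d` is uniform on `Fin M`, `x d ∼ p`, and `x j ∼ q` independently for `j ≠ d`. -/
noncomputable def jointBatch {X : Type*} (M : ℕ) (p q : X → ℝ)
    (d : Fin M) (x : Fin M → X) : ℝ :=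
  (1 / (M : ℝ)) * p (x d) * ∏ j ∈ Finset.univ.erase d, q (x j)

/-- The InfoNCE cross-entropy loss of a scoring function `f`:
`L(f) = E[ − log( f(x_d) / ∑_j f(x_j) ) ]`. -/
noncomputable def infoNCELoss {X : Type*} [Fintype X] (M : ℕ) (p q : X → ℝ)
    (f : X → ℝ) : ℝ :=
  ∑ d : Fin M, ∑ x : Fin M → X,
    jointBatch M p q d x * (- Real.log (f (x d) / ∑ j, f (x j)))

/-- Each summand of Gibbs' inequality, from `log t ≤ t - 1`. -/
theorem mul_neg_log_le_add {a b : ℝ} (ha : 0 ≤ a) (hb : 0 < b) :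
    a * -Real.log a ≤ a * -Real.log b + (b - a) := by
  rcases ha.eq_or_lt with rfl | ha
  · simpa using hb.le
  · have h := mul_le_mul_of_nonneg_left (Real.log_le_sub_one_of_pos (div_pos hb ha)) ha.le
    rw [Real.log_div hb.ne' ha.ne', mul_sub, mul_sub, mul_div_cancel₀ b ha.ne'] at h
    linarith

/-- Gibbs' inequality for unnormalized finite weights. -/
theorem sum_mul_neg_log_div_sum_le {ι : Type*} [Fintype ι] (a b : ι → ℝ)
    (ha : ∀ i, 0 ≤ a i) (hb : ∀ i, 0 < b i) :
    ∑ i, a i * -Real.log (a i / ∑ j, a j) ≤ ∑ i, a i * -Real.log (b i / ∑ j, b j) := by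
  rcases (Finset.sum_nonneg fun i _ => ha i : 0 ≤ ∑ i, a i).eq_or_lt with hA | hA
  · have h0 : ∀ i, a i = 0 := fun i =>
      (Finset.sum_eq_zero_iff_of_nonneg fun i _ => ha i).1 hA.symm i (Finset.mem_univ i)
    simp [h0]
  · have hne : (Finset.univ : Finset ι).Nonempty := Finset.nonempty_of_sum_ne_zero hA.ne'
    have hB : 0 < ∑ i, b i := Finset.sum_pos (fun i _ => hb i) hne
    set A := ∑ i, a i with hAdef
    set B := ∑ i, b i with hBdef
    calc ∑ i, a i * -Real.log (a i / A)
        ≤ ∑ i, (a i * -Real.log (b i / B) + A * (b i / B - a i / A)) := by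
          refine Finset.sum_le_sum fun i _ => ?_
          have h := mul_le_mul_of_nonneg_left
            (mul_neg_log_le_add (div_nonneg (ha i) hA.le) (div_pos (hb i) hB)) hA.le
          rwa [mul_add, ← mul_assoc, ← mul_assoc, mul_div_cancel₀ (a i) hA.ne'] at h
      _ = ∑ i, a i * -Real.log (b i / B) := by
          rw [Finset.sum_add_distrib, ← Finset.mul_sum, Finset.sum_sub_distrib,
            ← Finset.sum_div, ← Finset.sum_div, ← hAdef, ← hBdef, div_self hA.ne',
            div_self hB.ne', sub_self, mul_zero, add_zero]

/-- The joint pmf is the density ratio at `x d` times a factor not depending on `d`. -/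
theorem jointBatch_eq_mul_ratio {X : Type*} (M : ℕ) (p q : X → ℝ) (hq : ∀ x, 0 < q x)
    (d : Fin M) (x : Fin M → X) :
    jointBatch M p q d x = (1 / (M : ℝ) * ∏ j, q (x j)) * (p (x d) / q (x d)) := by
  have := (hq (x d)).ne'
  rw [jointBatch, ← Finset.mul_prod_erase Finset.univ (fun j => q (x j)) (Finset.mem_univ d)]
  field_simp

/-- The loss as an expectation over batches of an inner cross-entropy over indices. -/
theorem infoNCELoss_eq_sum_batch {X : Type*} [Fintype X] (M : ℕ) (p q : X → ℝ)
    (hq : ∀ x, 0 < q x) (f : X → ℝ) :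
    infoNCELoss M p q f = ∑ x : Fin M → X, (1 / (M : ℝ) * ∏ j, q (x j)) *
      ∑ d, p (x d) / q (x d) * -Real.log (f (x d) / ∑ j, f (x j)) := by
  rw [infoNCELoss, Finset.sum_comm]
  simp only [jointBatch_eq_mul_ratio M p q hq, mul_assoc, Finset.mul_sum]

/-- **The density ratio minimizes the InfoNCE loss**: for every positive scoring
function `f`, `L(p/q) ≤ L(f)`. -/
theorem infoNCELoss_ratio_le {X : Type*} [Fintype X]
    (M : ℕ) (hM : 1 ≤ M)
    (p : X → ℝ) (hp : ∀ x, 0 ≤ p x) (hps : ∑ x, p x = 1)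
    (q : X → ℝ) (hq : ∀ x, 0 < q x) (hqs : ∑ x, q x = 1)
    (f : X → ℝ) (hf : ∀ x, 0 < f x) :
    infoNCELoss M p q (fun x => p x / q x) ≤ infoNCELoss M p q f := by
  rw [infoNCELoss_eq_sum_batch M p q hq, infoNCELoss_eq_sum_batch M p q hq]
  refine Finset.sum_le_sum fun x _ => mul_le_mul_of_nonneg_left ?_
    (mul_nonneg (by positivity) (Finset.prod_nonneg fun j _ => (hq (x j)).le))
  exact sum_mul_neg_log_div_sum_le (fun d => p (x d) / q (x d)) (fun d => f (x d))
    (fun d => div_nonneg (hp _) (hq _).le) fun d => hf _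
end
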